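/- Let G be a finite simple graph and S ⊆ V a connected set with |S| ≥ 2. The map sending a triple (B, lb, rb), where B is a block of G[S] and (lb, rb) is an ordered CCP-pair of B, to the pair (grow(lb, S \ rb), S \ grow(lb, S \ rb)) is a bijection from the set of all such triples onto the set of all ordered CCP-pairs of S. -/

import Mathlib

open SimpleGraph

variable {V : Type*}

/-- `(Sl, Sr)` is an ordered CCP-pair of `S` in graph `G`. -/
def CCP (G : SimpleGraph V) (S Sl Sr : Set V) : Prop :=
  Sl.Nonempty ∧ Sr.Nonempty ∧ Sl ∩ Sr = ∅ ∧ Sl ∪ Sr = S ∧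
  (G.induce Sl).Connected ∧ (G.induce Sr).Connected ∧
  ∃ a ∈ Sl, ∃ b ∈ Sr, G.Adj a b

/-- `B` is a block (maximal nonseparable subgraph) of `G[S]`. -/
def IsBlock (G : SimpleGraph V) (S B : Set V) : Prop :=
  B ⊆ S ∧ 2 ≤ B.ncard ∧ (G.induce B).Connected ∧
  (∀ v ∈ B, (G.induce (B \ {v})).Connected) ∧
  ∀ B' : Set V, B ⊆ B' → B' ⊆ S → 2 ≤ B'.ncard → (G.induce B').Connected →
    (∀ v ∈ B', (G.induce (B' \ {v})).Connected) → B' = B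

/-- `grow G X Y` is the set of vertices of `Y` reachable in `G[Y]` from some vertex of `X`. -/
def grow (G : SimpleGraph V) (X Y : Set V) : Set V :=
  {y | ∃ hy : y ∈ Y, ∃ x, ∃ hx : x ∈ Y, x ∈ X ∧ (G.induce Y).Reachable ⟨x, hx⟩ ⟨y, hy⟩}

/-- A union of connected patches, each containing a point of the base set `C`, is connected. -/
lemma connected_of_connected_patches {G : SimpleGraph V} {X C : Set V}
    (hC : (G.induce C).Connected) (hCX : C ⊆ X)
    (h : ∀ z ∈ X, ∃ D ⊆ X, z ∈ D ∧ (D ∩ C).Nonempty ∧ (G.induce D).Connected) :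
    (G.induce X).Connected := by
  obtain ⟨⟨c, hc⟩⟩ := hC.nonempty
  refine induce_connected_of_patches c (hCX hc) fun {z} hz => ?_
  obtain ⟨D, hDX, hzD, hDC, hD⟩ := h z hz
  refine ⟨D ∪ C, Set.union_subset hDX hCX, Or.inr hc, Or.inl hzD, ?_⟩
  exact (induce_union_connected hD.preconnected hC.preconnected hDC).preconnected _ _

lemma mem_of_mem_support_map_induce {G : SimpleGraph V} {X : Set V} {a b : X}
    (p : (G.induce X).Walk a b) {v : V}
    (hv : v ∈ (p.map (Embedding.induce X).toHom).support) : v ∈ X := by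
  rw [Walk.support_map, List.mem_map] at hv
  obtain ⟨w, -, rfl⟩ := hv
  exact w.2

lemma exists_isPath_of_induce_connected {G : SimpleGraph V} {X : Set V}
    (hX : (G.induce X).Connected) {x y : V} (hx : x ∈ X) (hy : y ∈ X) :
    ∃ p : G.Walk x y, p.IsPath ∧ ∀ z ∈ p.support, z ∈ X := by
  classical
  obtain ⟨p⟩ := hX.preconnected ⟨x, hx⟩ ⟨y, hy⟩
  refine ⟨(p.map (Embedding.induce X).toHom).bypass, Walk.bypass_isPath _, fun z hz =>
    mem_of_mem_support_map_induce p (Walk.support_bypass_subset_support _ hz)⟩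

lemma exists_adj_across_of_induce_connected {G : SimpleGraph V} {X : Set V}
    (hX : (G.induce X).Connected) (T : Set V) {x y : V} (hx : x ∈ X) (hy : y ∈ X)
    (hxT : x ∈ T) (hyT : y ∉ T) :
    ∃ a ∈ X, ∃ b ∈ X, a ∈ T ∧ b ∉ T ∧ G.Adj a b := by
  obtain ⟨p, -, hp⟩ := exists_isPath_of_induce_connected hX hx hy
  obtain ⟨d, hd, ha, hb⟩ := p.exists_boundary_dart T hxT hyT
  exact ⟨d.fst, hp _ (p.dart_fst_mem_support_of_mem_darts hd), d.snd,
    hp _ (p.dart_snd_mem_support_of_mem_darts hd), ha, hb, d.adj⟩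

section Grow

variable {G : SimpleGraph V} {X Y : Set V}

lemma grow_subset : grow G X Y ⊆ Y := fun _ hy => hy.1

lemma subset_grow (h : X ⊆ Y) : X ⊆ grow G X Y :=
  fun x hx => ⟨h hx, x, h hx, hx, Reachable.refl _⟩

lemma mem_grow_of_adj {y z : V} (hy : y ∈ grow G X Y) (hz : z ∈ Y) (h : G.Adj y z) :
    z ∈ grow G X Y := by
  obtain ⟨hyY, x, hxY, hx, hr⟩ := hy
  exact ⟨hz, x, hxY, hx, hr.trans (Adj.reachable (by simpa using h))⟩

lemma grow_subset_of_closed {T : Set V} (hXT : X ∩ Y ⊆ T)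
    (hT : ∀ a ∈ Y, ∀ b ∈ Y, a ∈ T → G.Adj a b → b ∈ T) : grow G X Y ⊆ T := by
  rintro y ⟨hy, x, hxY, hx, ⟨p⟩⟩
  by_contra hyT
  obtain ⟨d, -, ha, hb⟩ := p.exists_boundary_dart {v | (v : V) ∈ T} (hXT ⟨hx, hxY⟩) hyT
  exact hb (hT _ d.fst.2 _ d.snd.2 ha (by simpa using d.adj))

lemma subset_grow_of_connected {Z : Set V} (hZ : (G.induce Z).Connected) (hZY : Z ⊆ Y)
    (hXZ : (X ∩ Z).Nonempty) : Z ⊆ grow G X Y := by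
  intro z hz
  by_contra hzg
  obtain ⟨x, hx, hxZ⟩ := hXZ
  obtain ⟨a, -, b, hb, hag, hbg, hab⟩ := exists_adj_across_of_induce_connected hZ (grow G X Y)
    hxZ hz ⟨hZY hxZ, x, hZY hxZ, hx, Reachable.refl _⟩ hzg
  exact hbg (mem_grow_of_adj hag (hZY hb) hab)

lemma grow_connected (hX : (G.induce X).Connected) (hXY : X ⊆ Y) :
    (G.induce (grow G X Y)).Connected := by
  refine connected_of_connected_patches hX (subset_grow hXY) ?_
  rintro z ⟨hz, x, hxY, hx, ⟨p⟩⟩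
  set q := p.map (Embedding.induce Y).toHom
  have hqc := q.connected_induce_support
  have hx : x ∈ X := hx
  refine ⟨{v | v ∈ q.support}, subset_grow_of_connected hqc 
    (fun v hv => mem_of_mem_support_map_induce p hv) ⟨x, hx, q.start_mem_support⟩, q.end_mem_support, ⟨x, q.start_mem_support, hx⟩, hqc⟩

end Grow

/-- Growing the left half of a CCP-pair of a subset `B` of a connected set `S` gives a CCP-pair
of `S`. -/
lemma CCP.grow {G : SimpleGraph V} {S B lb rb : Set V} (hS : (G.induce S).Connected)
    (hBS : B ⊆ S) (h : CCP G B lb rb) :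
    CCP G S (grow G lb (S \ rb)) (S \ grow G lb (S \ rb)) := by
  obtain ⟨⟨l, hl⟩, ⟨r, hr⟩, hdisj, rfl, hlc, hrc, a, ha, b, hb, hab⟩ := h
  have hlS : lb ⊆ S \ rb := fun x hx =>
    ⟨hBS (Or.inl hx), fun hx' => (hdisj ▸ (⟨hx, hx'⟩ : x ∈ lb ∩ rb) : x ∈ (∅ : Set V))⟩
  set L := _root_.grow G lb (S \ rb) with hL
  have hlL : lb ⊆ L := subset_grow hlS
  have hLS : L ⊆ S := fun x hx => (grow_subset hx).1
  have hrR : rb ⊆ S \ L := fun x hx => ⟨hBS (Or.inr hx), fun hx' => (grow_subset hx').2 hx⟩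
  have hR : (G.induce (S \ L)).Connected := by
    have hC := grow_connected hrc hrR
    suffices _root_.grow G rb (S \ L) = S \ L by rwa [this] at hC
    refine grow_subset.antisymm fun x hx => ?_
    by_contra hxC
    obtain ⟨u, hu, v, hv, huT, hvT, huv⟩ := exists_adj_across_of_induce_connected hS
      (L ∪ _root_.grow G rb (S \ L)) (hLS (hlL hl)) hx.1 (Or.inl (hlL hl))
      (fun h => h.elim hx.2 hxC)
    have hvL : v ∉ L := fun h => hvT (Or.inl h)
    have hvC : v ∉ _root_.grow G rb (S \ L) := fun h => hvT (Or.inr h)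
    rcases huT with huL | huC
    · have hvr : v ∉ rb := fun h => hvC (subset_grow hrR h)
      exact hvL (mem_grow_of_adj huL ⟨hv, hvr⟩ huv)
    · exact hvC (mem_grow_of_adj huC ⟨hv, hvL⟩ huv)
  exact ⟨⟨l, hlL hl⟩, ⟨r, hrR hr⟩, Set.inter_sdiff_self _ _, Set.union_sdiff_cancel hLS,
    grow_connected hlc hlS, hR, a, hlL ha, b, hrR hb, hab⟩

/-- A set of at least two vertices inducing a connected subgraph without cut vertices. -/
def Nonseparable (G : SimpleGraph V) (B : Set V) : Prop :=
  2 ≤ B.ncard ∧ (G.induce B).Connected ∧ ∀ v ∈ B, (G.induce (B \ {v})).Connected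

lemma Nonseparable.connected_diff {G : SimpleGraph V} {B : Set V} (hB : Nonseparable G B)
    (v : V) : (G.induce (B \ {v})).Connected := by
  by_cases hv : v ∈ B
  · exact hB.2.2 v hv
  · rw [Set.sdiff_singleton_eq_self hv]
    exact hB.2.1

lemma nonseparable_pair {G : SimpleGraph V} {a b : V} (h : G.Adj a b) :
    Nonseparable G {a, b} := by
  refine ⟨(Set.ncard_pair h.ne).ge, induce_pair_connected_of_adj h, ?_⟩
  have hs : ∀ c : V, (G.induce {c}).Connected := fun c =>
    { preconnected := Preconnected.of_subsingleton, nonempty := ⟨⟨c, rfl⟩⟩ }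
  rintro v (rfl | rfl)
  · rw [Set.insert_sdiff_self_of_notMem (by simpa using h.ne)]
    exact hs b
  · rw [Set.pair_comm, Set.insert_sdiff_self_of_notMem (by simpa using h.ne')]
    exact hs a

lemma Nonseparable.union [Finite V] {G : SimpleGraph V} {A B : Set V} (hA : Nonseparable G A)
    (hB : Nonseparable G B) {u w : V} (huw : u ≠ w) (hu : u ∈ A ∩ B) (hw : w ∈ A ∩ B) :
    Nonseparable G (A ∪ B) := by
  refine ⟨hA.1.trans (Set.ncard_le_ncard Set.subset_union_left),
    induce_union_connected hA.2.1.preconnected hB.2.1.preconnected ⟨u, hu⟩, fun v _ => ?_⟩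
  rw [Set.union_sdiff_distrib]
  refine induce_union_connected (hA.connected_diff v).preconnected
    (hB.connected_diff v).preconnected ?_
  by_cases huv : u = v
  · exact ⟨w, ⟨hw.1, fun h => huw (huv.trans (Eq.symm h))⟩,
      ⟨hw.2, fun h => huw (huv.trans (Eq.symm h))⟩⟩
  · exact ⟨u, ⟨hu.1, huv⟩, ⟨hu.2, huv⟩⟩

/-- Attaching an ear to a nonseparable set gives a nonseparable set. -/
lemma Nonseparable.union_support [Finite V] {G : SimpleGraph V} {B : Set V}
    (hB : Nonseparable G B) {u w : V} (hu : u ∈ B) (hw : w ∈ B)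
    {p : G.Walk u w} (hp : p.IsPath) : Nonseparable G (B ∪ {v | v ∈ p.support}) := by
  classical
  refine ⟨hB.1.trans (Set.ncard_le_ncard Set.subset_union_left),
    induce_union_connected hB.2.1.preconnected p.connected_induce_support.preconnected
      ⟨u, hu, p.start_mem_support⟩, fun v _ => ?_⟩
  refine connected_of_connected_patches (hB.connected_diff v)
    (Set.sdiff_subset_sdiff_left Set.subset_union_left) ?_
  rintro z ⟨hz | hz, hzv⟩
  · exact ⟨B \ {v}, Set.sdiff_subset_sdiff_left Set.subset_union_left, ⟨hz, hzv⟩,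
      ⟨z, ⟨hz, hzv⟩, hz, hzv⟩, hB.connected_diff v⟩
  have hz : z ∈ p.support := hz
  by_cases hv : v ∈ (p.takeUntil z hz).support
  · have hv' : v ∉ (p.dropUntil z hz).support := by
      intro hv'
      have hnd := hp.support_nodup
      rw [← p.take_spec hz, Walk.support_append, List.nodup_append] at hnd
      rw [Walk.mem_support_iff] at hv'
      exact hv'.elim (fun h => hzv h.symm) fun h => hnd.2.2 v hv v h rfl
    have hc := (p.dropUntil z hz).connected_induce_support
    refine ⟨_, fun x hx => ⟨Or.inr (p.support_dropUntil_subset_support hz hx), ?_⟩,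
      (p.dropUntil z hz).start_mem_support, ⟨w, (p.dropUntil z hz).end_mem_support, hw, ?_⟩, hc⟩
    · rintro rfl
      exact hv' hx
    · rintro rfl
      exact hv' (Walk.end_mem_support _)
  · have hc := (p.takeUntil z hz).connected_induce_support
    refine ⟨_, fun x hx => ⟨Or.inr (p.support_takeUntil_subset_support hz hx), ?_⟩,
      (p.takeUntil z hz).end_mem_support, ⟨u, (p.takeUntil z hz).start_mem_support, hu, ?_⟩, hc⟩
    · rintro rfl
      exact hv hx
    · rintro rfl
      exact hv (Walk.start_mem_support _)

section Block

variable {G : SimpleGraph V} {S B : Set V}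

lemma IsBlock.nonseparable (hB : IsBlock G S B) : Nonseparable G B :=
  ⟨hB.2.1, hB.2.2.1, hB.2.2.2.1⟩

lemma IsBlock.eq_of_subset (hB : IsBlock G S B) {A : Set V} (hA : Nonseparable G A)
    (hBA : B ⊆ A) (hAS : A ⊆ S) : A = B :=
  hB.2.2.2.2 A hBA hAS hA.1 hA.2.1 hA.2.2

lemma IsBlock.eq_of_mem [Finite V] {B' : Set V} (hB : IsBlock G S B) (hB' : IsBlock G S B')
    {u w : V} (huw : u ≠ w) (hu : u ∈ B ∩ B') (hw : w ∈ B ∩ B') : B = B' := by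
  have h := hB.nonseparable.union hB'.nonseparable huw hu hw
  have hS := Set.union_subset hB.1 hB'.1
  exact (hB.eq_of_subset h Set.subset_union_left hS).symm.trans
    (hB'.eq_of_subset h Set.subset_union_right hS)

lemma Nonseparable.exists_isBlock [Finite V] {A : Set V} (hA : Nonseparable G A) (hAS : A ⊆ S) :
    ∃ B, IsBlock G S B ∧ A ⊆ B := by
  obtain ⟨B, hAB, hB⟩ := (Set.toFinite {B | Nonseparable G B ∧ B ⊆ S}).exists_le_maximal
    (⟨hA, hAS⟩ : A ∈ {B | Nonseparable G B ∧ B ⊆ S})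
  refine ⟨B, ⟨hB.prop.2, hB.prop.1.1, hB.prop.1.2.1, hB.prop.1.2.2, ?_⟩, hAB⟩
  intro B' hBB' hB'S h2 hc hs
  exact (hB.le_of_ge ⟨⟨h2, hc, hs⟩, hB'S⟩ hBB').antisymm hBB'

lemma IsBlock.support_subset [Finite V] (hB : IsBlock G S B) {u w : V}
    (hu : u ∈ B) (hw : w ∈ B) {p : G.Walk u w} (hp : p.IsPath) (hpS : ∀ v ∈ p.support, v ∈ S) :
    ∀ v ∈ p.support, v ∈ B := by
  intro v hv
  rw [← hB.eq_of_subset (hB.nonseparable.union_support hu hw hp) Set.subset_union_left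
    (Set.union_subset hB.1 hpS)]
  exact Or.inr hv

/-- A block meets every connected set in a connected set. -/
lemma IsBlock.inter_connected [Finite V] (hB : IsBlock G S B) {X : Set V} (hXS : X ⊆ S)
    (hX : (G.induce X).Connected) (hne : (X ∩ B).Nonempty) : (G.induce (X ∩ B)).Connected := by
  obtain ⟨u, huX, huB⟩ := hne
  refine induce_connected_of_patches u ⟨huX, huB⟩ fun {w} hw => ?_
  obtain ⟨p, hp, hpX⟩ := exists_isPath_of_induce_connected hX huX hw.1
  have hpB := hB.support_subset huB hw.2 hp fun v hv => hXS (hpX v hv)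
  exact ⟨{v | v ∈ p.support}, fun v hv => ⟨hpX v hv, hpB v hv⟩, p.start_mem_support,
    p.end_mem_support, p.connected_induce_support.preconnected _ _⟩

/-- A block containing vertices from both sides of a CCP-pair of `S` contains every edge across
it. -/
lemma IsBlock.mem_of_adj_across [Finite V] (hB : IsBlock G S B) {L R : Set V}
    (h : CCP G S L R) {a b a' b' : V} (ha : a ∈ L) (hb : b ∈ R) (ha' : a' ∈ L) (hb' : b' ∈ R)
    (hab' : G.Adj a' b') (haB : a ∈ B) (hbB : b ∈ B) : a' ∈ B ∧ b' ∈ B := by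
  obtain ⟨-, -, hdisj, rfl, hL, hR, -⟩ := h
  obtain ⟨p, hp, hpL⟩ := exists_isPath_of_induce_connected hL ha ha'
  obtain ⟨q, hq, hqR⟩ := exists_isPath_of_induce_connected hR hb' hb
  have hsupp : (p.append (Walk.cons hab' q)).support = p.support ++ q.support := by
    simp [Walk.support_append]
  have hpath : (p.append (Walk.cons hab' q)).IsPath := by
    rw [Walk.isPath_def, hsupp, List.nodup_append]
    refine ⟨hp.support_nodup, hq.support_nodup, ?_⟩
    rintro x hx _ hy rfl
    exact (hdisj ▸ (⟨hpL x hx, hqR x hy⟩ : x ∈ L ∩ R) : x ∈ (∅ : Set V))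
  have hsub := hB.support_subset haB hbB hpath fun v hv => by
    rw [hsupp, List.mem_append] at hv
    exact hv.imp (hpL v) (hqR v)
  exact ⟨hsub a' (by simp [hsupp]), hsub b' (by simp [hsupp])⟩

end Block

lemma grow_diff_inter_eq {G : SimpleGraph V} {S B lb rb : Set V} (hBS : B ⊆ S)
    (h : CCP G B lb rb) : grow G lb (S \ rb) ∩ B = lb := by
  obtain ⟨-, -, hdisj, rfl, -⟩ := h
  have hlS : lb ⊆ S \ rb := fun y hy => ⟨hBS (Or.inl hy), fun hy' =>
    (hdisj ▸ (⟨hy, hy'⟩ : y ∈ lb ∩ rb) : y ∈ (∅ : Set V))⟩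
  exact Set.ext fun x => ⟨fun hx => hx.2.resolve_right (grow_subset hx.1).2,
    fun hx => ⟨subset_grow hlS hx, Or.inl hx⟩⟩

lemma CCP.right_eq {G : SimpleGraph V} {S L R : Set V} (h : CCP G S L R) : R = S \ L := by
  obtain ⟨-, -, hdisj, rfl, -⟩ := h
  rw [Set.union_sdiff_left, (Set.disjoint_iff_inter_eq_empty.2 hdisj).symm.sdiff_eq_left]

/-- Every CCP-pair of `S` grows from the pair it induces on some block. -/
lemma CCP.exists_grow_eq [Finite V] {G : SimpleGraph V} {S L R : Set V} (h : CCP G S L R) :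
    ∃ B lb rb, IsBlock G S B ∧ CCP G B lb rb ∧ _root_.grow G lb (S \ rb) = L := by
  have hccp := h
  obtain ⟨-, -, hdisj, rfl, hL, hR, a, ha, b, hb, hab⟩ := h
  obtain ⟨B, hB, habB⟩ := (nonseparable_pair hab).exists_isBlock (S := L ∪ R) (by
    rintro x (rfl | rfl)
    exacts [Or.inl ha, Or.inr hb])
  have haB : a ∈ B := habB (by simp)
  have hbB : b ∈ B := habB (by simp)
  have hnot : ∀ x ∈ L, x ∉ R := fun x hx hx' =>
    (hdisj ▸ (⟨hx, hx'⟩ : x ∈ L ∩ R) : x ∈ (∅ : Set V))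
  refine ⟨B, L ∩ B, R ∩ B, hB, ⟨⟨a, ha, haB⟩, ⟨b, hb, hbB⟩, ?_, ?_,
    hB.inter_connected Set.subset_union_left hL ⟨a, ha, haB⟩,
    hB.inter_connected Set.subset_union_right hR ⟨b, hb, hbB⟩,
    a, ⟨ha, haB⟩, b, ⟨hb, hbB⟩, hab⟩, ?_⟩
  · rw [← Set.inter_inter_distrib_right, hdisj, Set.empty_inter]
  · rw [← Set.union_inter_distrib_right, Set.inter_eq_right.2 hB.1]
  · refine (grow_subset_of_closed (fun x hx => hx.1.1) ?_).antisymm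
      (subset_grow_of_connected hL (fun x hx => ⟨Or.inl hx, fun hx' => hnot x hx hx'.1⟩)
        ⟨a, ⟨ha, haB⟩, ha⟩)
    intro x _ y hy hx hxy
    refine hy.1.resolve_right fun hyR => hy.2 ⟨hyR, ?_⟩
    exact (hB.mem_of_adj_across hccp ha hb hx hyR hxy haB hbB).2

/-- For connected `S` with `|S| ≥ 2`, the map
`(B, lb, rb) ↦ (grow(lb, S \ rb), S \ grow(lb, S \ rb))` is a bijection from the set of
triples where `B` is a block of `G[S]` and `(lb, rb)` an ordered CCP-pair of `B`, onto the
set of ordered CCP-pairs of `S`. -/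
theorem stmt10 [Fintype V] (G : SimpleGraph V) (S : Set V)
    (hconn : (G.induce S).Connected) (h2 : 2 ≤ S.ncard) :
    ∃ f : {t : Set V × Set V × Set V // IsBlock G S t.1 ∧ CCP G t.1 t.2.1 t.2.2} ≃
          {p : Set V × Set V // CCP G S p.1 p.2},
      ∀ t, (f t : Set V × Set V) =
        (grow G t.1.2.1 (S \ t.1.2.2), S \ grow G t.1.2.1 (S \ t.1.2.2)) := by
  refine ⟨Equiv.ofBijective (fun t => ⟨(grow G t.1.2.1 (S \ t.1.2.2),
    S \ grow G t.1.2.1 (S \ t.1.2.2)), t.2.2.grow hconn t.2.1.1⟩) ⟨?_, ?_⟩, fun t => rfl⟩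
  · rintro ⟨⟨B, lb, rb⟩, hB, hc⟩ ⟨⟨B', lb', rb'⟩, hB', hc'⟩ heq
    dsimp only at hB hc hB' hc'
    have hgrow : grow G lb (S \ rb) = grow G lb' (S \ rb') :=
      congrArg Prod.fst (congrArg Subtype.val heq)
    have hccp := hc.grow hconn hB.1
    have hi := grow_diff_inter_eq hB.1 hc
    have hi' := grow_diff_inter_eq hB'.1 hc'
    have hr := hc.right_eq
    have hr' := hc'.right_eq
    obtain ⟨-, -, -, hu, -, -, a, ha, b, hb, hab⟩ := hc
    obtain ⟨-, -, -, hu', -, -, a', ha', b', hb', hab'⟩ := hc'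
    have haB : a ∈ B := hu ▸ Or.inl ha
    have hbB : b ∈ B := hu ▸ Or.inr hb
    have haB' : a' ∈ B' := hu' ▸ Or.inl ha'
    have hbB' : b' ∈ B' := hu' ▸ Or.inr hb'
    have haL : a ∈ grow G lb (S \ rb) := (hi.ge ha).1
    have haL' : a' ∈ grow G lb (S \ rb) := hgrow ▸ (hi'.ge ha').1
    have hbR : b ∈ S \ grow G lb (S \ rb) := ⟨hB.1 hbB, fun h => (grow_subset h).2 hb⟩
    have hbR' : b' ∈ S \ grow G lb (S \ rb) :=
      ⟨hB'.1 hbB', fun h => (grow_subset (hgrow ▸ h)).2 hb'⟩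
    obtain ⟨h₁, h₂⟩ := hB.mem_of_adj_across hccp haL hbR haL' hbR' hab' haB hbB
    obtain rfl := hB.eq_of_mem hB' hab'.ne ⟨h₁, haB'⟩ ⟨h₂, hbB'⟩
    obtain rfl : lb = lb' := by rw [← hi, ← hi', hgrow]
    obtain rfl : rb = rb' := hr.trans hr'.symm
    rfl
  · rintro ⟨⟨L, R⟩, h⟩
    obtain ⟨B, lb, rb, hB, hc, hg⟩ := h.exists_grow_eq
    refine ⟨⟨(B, lb, rb), hB, hc⟩, Subtype.ext (Prod.ext hg ?_)⟩
    exact (congrArg (S \ ·) hg).trans h.right_eq.symm
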